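/- Assume D = Z0ᵀ Δ K Δ Z0 is invertible, let W = K − K Δ Z0 D⁻¹ Z0ᵀ Δ K, and assume w = 1_Tᵀ W 1_T ≠ 0, that Z0ᵀ W Z0 is invertible, and that G̃0 = X0ᵀ W X0 − (1/w) X0ᵀ W 1_T 1_Tᵀ W X0 is invertible. Set μ̃0 = (1/w) X0ᵀ W 1_T, μ̃1 = (1/w) X1ᵀ W 1_T, and G̃1 = X1ᵀ W X0 − (1/w) X1ᵀ W 1_T 1_Tᵀ W X0. Then the r×(r+1) matrix B̃ = X1ᵀ W Z0 (Z0ᵀ W Z0)⁻¹ decomposes as B̃ = [m̃ | Ã], where its first column is m̃ = μ̃1 − Ã μ̃0 and its remaining r columns form the r×r matrix Ã = G̃1 G̃0⁻¹. -/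

import Mathlib

open Matrix

/-- decomposition of the local-linear WLS minimizer
`B̃ = X1ᵀ W Z0 (Z0ᵀ W Z0)⁻¹ = [m̃ | Ã]` with `Ã = G̃1 G̃0⁻¹` and
`m̃ = μ̃1 − Ã μ̃0`, where `W = K − K Δ Z0 D⁻¹ Z0ᵀ Δ K`. -/
theorem stmt_6 {T r : ℕ} (hT : 0 < T) (hr : 0 < r)
    (X0 X1 : Matrix (Fin T) (Fin r) ℝ)
    (d : Fin T → ℝ) (hd : ∀ t, 0 < d t)
    (K : Matrix (Fin T) (Fin T) ℝ) (hK : K = Matrix.diagonal d)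
    (u : ℝ)
    (Δ : Matrix (Fin T) (Fin T) ℝ)
    (hΔ : Δ = Matrix.diagonal (fun t : Fin T => ((t : ℝ) + 1) / T - u))
    (ones : Fin T → ℝ) (hones : ones = fun _ => 1)
    (Z0 : Matrix (Fin T) (Fin (r + 1)) ℝ) (hZ0 : ∀ t, Z0 t = Fin.cons 1 (X0 t))
    (D : Matrix (Fin (r + 1)) (Fin (r + 1)) ℝ) (hD : D = Z0ᵀ * Δ * K * Δ * Z0)
    (hinvD : IsUnit D)
    (W : Matrix (Fin T) (Fin T) ℝ)
    (hW : W = K - K * Δ * Z0 * D⁻¹ * Z0ᵀ * Δ * K)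
    (w : ℝ) (hw : w = ones ⬝ᵥ (W *ᵥ ones)) (hwne : w ≠ 0)
    (hinvZ : IsUnit (Z0ᵀ * W * Z0))
    (G0 : Matrix (Fin r) (Fin r) ℝ)
    (hG0 : G0 = X0ᵀ * W * X0 -
      (1 / w) • Matrix.vecMulVec (X0ᵀ *ᵥ (W *ᵥ ones)) (ones ᵥ* (W * X0)))
    (hinvG : IsUnit G0)
    (μ0 : Fin r → ℝ) (hμ0 : μ0 = (1 / w) • (X0ᵀ *ᵥ (W *ᵥ ones)))
    (μ1 : Fin r → ℝ) (hμ1 : μ1 = (1 / w) • (X1ᵀ *ᵥ (W *ᵥ ones)))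
    (G1 : Matrix (Fin r) (Fin r) ℝ)
    (hG1 : G1 = X1ᵀ * W * X0 -
      (1 / w) • Matrix.vecMulVec (X1ᵀ *ᵥ (W *ᵥ ones)) (ones ᵥ* (W * X0)))
    (Btil : Matrix (Fin r) (Fin (r + 1)) ℝ)
    (hBtil : Btil = X1ᵀ * W * Z0 * (Z0ᵀ * W * Z0)⁻¹)
    (Atil : Matrix (Fin r) (Fin r) ℝ) (hAtil : Atil = G1 * G0⁻¹)
    (mtil : Fin r → ℝ) (hmtil : mtil = μ1 - Atil *ᵥ μ0) :
    (∀ i, Btil i 0 = mtil i) ∧ (∀ i j, Btil i j.succ = Atil i j) := by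
  set C : Matrix (Fin r) (Fin (r + 1)) ℝ := Matrix.of fun i => Fin.cons (mtil i) (Atil i) with hC
  have hCZ : C * Z0ᵀ = vecMulVec mtil ones + Atil * X0ᵀ := by
    ext i t
    simp [mul_apply, Fin.sum_univ_succ, hC, hZ0, hones, vecMulVec_apply]
  have hcol : ∀ {n : ℕ} (M : Matrix (Fin n) (Fin T) ℝ) (i : Fin n),
      (M * Z0) i 0 = (M *ᵥ ones) i := by
    intro n M i
    simp [mul_apply, mulVec, dotProduct, hZ0, hones]
  have hcols : ∀ {n : ℕ} (M : Matrix (Fin n) (Fin T) ℝ) (i : Fin n) (j : Fin r),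
      (M * Z0) i j.succ = (M * X0) i j := by
    intro n M i j
    simp [mul_apply, hZ0]
  have hAG : Atil * G0 = G1 := by
    rw [hAtil, Matrix.mul_assoc, nonsing_inv_mul _ ((isUnit_iff_isUnit_det _).1 hinvG),
      Matrix.mul_one]
  have hμ0' : X0ᵀ *ᵥ (W *ᵥ ones) = w • μ0 := by
    rw [hμ0, smul_smul, mul_one_div_cancel hwne, one_smul]
  have hμ1' : X1ᵀ *ᵥ (W *ᵥ ones) = w • μ1 := by
    rw [hμ1, smul_smul, mul_one_div_cancel hwne, one_smul]
  have hconst : (vecMulVec mtil ones + Atil * X0ᵀ) *ᵥ (W *ᵥ ones) = X1ᵀ *ᵥ (W *ᵥ ones) := by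
    rw [add_mulVec, ← mulVec_mulVec, hμ0', hμ1', vecMulVec_mulVec, ← hw, hmtil, mulVec_smul]
    ext i
    simp
    ring
  have hslope : (vecMulVec mtil ones + Atil * X0ᵀ) * (W * X0) = X1ᵀ * (W * X0) := by
    rw [hG0, hG1, ← smul_vecMulVec, ← smul_vecMulVec, ← hμ0, ← hμ1, Matrix.mul_sub,
      mul_vecMulVec, Matrix.mul_assoc, Matrix.mul_assoc, ← Matrix.mul_assoc Atil] at hAG
    rw [Matrix.add_mul, vecMulVec_mul, hmtil, sub_vecMulVec, sub_add_eq_add_sub, add_sub_assoc,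
      Matrix.mul_assoc Atil, ← Matrix.mul_assoc Atil, hAG]
    abel
  have hnormal : C * (Z0ᵀ * W * Z0) = X1ᵀ * W * Z0 := by
    rw [← Matrix.mul_assoc, ← Matrix.mul_assoc, hCZ]
    ext i j
    refine Fin.cases ?_ (fun j => ?_) j
    · rw [hcol, hcol, ← mulVec_mulVec, ← mulVec_mulVec, hconst]
    · rw [hcols, hcols, Matrix.mul_assoc, Matrix.mul_assoc, hslope]
  have hBC : Btil = C := by
    rw [hBtil, ← hnormal, Matrix.mul_assoc,
      mul_nonsing_inv _ ((isUnit_iff_isUnit_det _).1 hinvZ), Matrix.mul_one]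
  simp [hBC, hC]
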